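/- For every positive integer n, the map V from compositions of n to compositions of n is a bijection, where V is defined as follows: given a composition c, append a final part 0 if c has odd length so that the parts come in consecutive pairs (c_{2i-1}, c_{2i}); replace each pair (x, y) with y − x < 1 by the sequence (1^{x-y}, 2y) (a run of x−y ones followed by the part 2y, with the part 2y omitted when y = 0), and replace each pair (x, y) with 2k−1 ≤ y−x < 2k+1 for the (unique) integer k ≥ 1 by the sequence (1^{x+y-2k-1}, 2k+1); concatenate the resulting sequences in order to obtain V(c). -/

import Mathlib

/-- A composition of `n`: a list of positive integers summing to `n`. -/
def IsComposition (n : ℕ) (l : List ℕ) : Prop :=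
  (∀ x ∈ l, 0 < x) ∧ l.sum = n

/-- The image of one pair `(x, y)` of parts under the map `V`:
if `y - x < 1` (i.e. `y ≤ x`) it becomes `(1^{x-y}, 2y)` with the part `2y`
omitted when `y = 0`; otherwise, with the unique `k ≥ 1` such that
`2k-1 ≤ y-x < 2k+1` (namely `k = (y-x+1)/2`), it becomes
`(1^{x+y-2k-1}, 2k+1)`. -/
def Vstep (x y : ℕ) : List ℕ :=
  if y ≤ x then List.replicate (x - y) 1 ++ (if y = 0 then [] else [2 * y])
  else List.replicate (x + y - 2 * ((y - x + 1) / 2) - 1) 1 ++ [2 * ((y - x + 1) / 2) + 1]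

/-- The map `V`: pair up consecutive parts (appending a final `0` when the
length is odd), apply `Vstep` to each pair, and concatenate. -/
def V : List ℕ → List ℕ
  | [] => []
  | [x] => Vstep x 0
  | x :: y :: rest => Vstep x y ++ V rest

/-- The first part of the pair that `Vstep` sends to `(1^m, b)`, for `b ≥ 2`. -/
def unstepFst (m b : ℕ) : ℕ :=
  if b % 2 = 0 then m + b / 2 else m / 2 + 1

/-- The second part of the pair that `Vstep` sends to `(1^m, b)`, for `b ≥ 2`. -/
def unstepSnd (m b : ℕ) : ℕ :=
  if b % 2 = 0 then b / 2 else m + b - unstepFst m b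

/-- The inverse of `V`, where `m` counts the ones read since the last larger part. -/
def unV : ℕ → List ℕ → List ℕ
  | m, [] => if m = 0 then [] else [m]
  | m, b :: l => if b = 1 then unV (m + 1) l else unstepFst m b :: unstepSnd m b :: unV 0 l

theorem unstepFst_pos {m b : ℕ} (hb : 2 ≤ b) : 0 < unstepFst m b := by
  grind [unstepFst]

theorem unstepSnd_pos {m b : ℕ} (hb : 2 ≤ b) : 0 < unstepSnd m b := by
  grind [unstepFst, unstepSnd]

theorem Vstep_zero_right (x : ℕ) : Vstep x 0 = List.replicate x 1 := by
  simp [Vstep]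

theorem Vstep_unstep {m b : ℕ} (hb : 2 ≤ b) :
    Vstep (unstepFst m b) (unstepSnd m b) = List.replicate m 1 ++ [b] := by
  rcases Nat.mod_two_eq_zero_or_one b with h | h
  · have h1 : unstepFst m b = m + b / 2 := by simp [unstepFst, h]
    have h2 : unstepSnd m b = b / 2 := by simp [unstepSnd, h]
    rw [h1, h2, Vstep, if_pos (by omega), if_neg (by omega),
      show m + b / 2 - b / 2 = m by omega, show 2 * (b / 2) = b by omega]
  · have h1 : unstepFst m b = m / 2 + 1 := by simp [unstepFst, h]
    have h2 : unstepSnd m b = m + b - (m / 2 + 1) := by simp [unstepSnd, h, h1]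
    have h3 : (m + b - (m / 2 + 1) - (m / 2 + 1) + 1) / 2 = b / 2 := by omega
    rw [h1, h2, Vstep, if_neg (by omega), h3,
      show m / 2 + 1 + (m + b - (m / 2 + 1)) - 2 * (b / 2) - 1 = m by omega,
      show 2 * (b / 2) + 1 = b by omega]

theorem exists_Vstep_eq {x y : ℕ} (hx : 0 < x) (hy : 0 < y) :
    ∃ m b, 2 ≤ b ∧ m + b = x + y ∧ Vstep x y = List.replicate m 1 ++ [b] ∧
      unstepFst m b = x ∧ unstepSnd m b = y := by
  by_cases h : y ≤ x
  · refine ⟨x - y, 2 * y, by omega, by omega, by simp [Vstep, h, hy.ne'], ?_, ?_⟩ <;>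
      grind [unstepFst, unstepSnd]
  · have h1 : unstepFst (x + y - 2 * ((y - x + 1) / 2) - 1) (2 * ((y - x + 1) / 2) + 1) = x := by
      rw [unstepFst, if_neg (by omega)]
      omega
    refine ⟨x + y - 2 * ((y - x + 1) / 2) - 1, 2 * ((y - x + 1) / 2) + 1, by omega, by omega,
      by simp [Vstep, h], h1, ?_⟩
    rw [unstepSnd, if_neg (by omega), h1]
    omega

theorem unV_replicate_append (k m : ℕ) (l : List ℕ) :
    unV m (List.replicate k 1 ++ l) = unV (m + k) l := by
  induction k generalizing m with
  | zero => simp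
  | succ k ih => simp [List.replicate_succ, unV, ih, Nat.add_comm, Nat.add_left_comm]

theorem unV_V : ∀ l : List ℕ, (∀ x ∈ l, 0 < x) → unV 0 (V l) = l
  | [], _ => by simp [V, unV]
  | [x], h => by
    have hx : 0 < x := h x (by simp)
    have := unV_replicate_append x 0 []
    simp_all [V, Vstep_zero_right, unV, hx.ne']
  | x :: y :: l, h => by
    obtain ⟨m, b, hb, -, hV, h1, h2⟩ := exists_Vstep_eq (h x (by simp)) (h y (by simp))
    have ih := unV_V l fun z hz => h z (by simp [hz])
    rw [V, hV, List.append_assoc, unV_replicate_append]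
    simp [unV, h1, h2, ih, show b ≠ 1 by omega]

theorem V_isComposition : ∀ l : List ℕ, (∀ x ∈ l, 0 < x) → IsComposition l.sum (V l)
  | [], _ => by simp [V, IsComposition]
  | [x], _ => by
    simp +contextual [V, Vstep_zero_right, IsComposition, List.mem_replicate]
  | x :: y :: l, h => by
    obtain ⟨m, b, hb, hs, hV, -, -⟩ := exists_Vstep_eq (h x (by simp)) (h y (by simp))
    obtain ⟨ih1, ih2⟩ := V_isComposition l fun z hz => h z (by simp [hz])
    rw [V, hV]
    constructor
    · grind
    · simp [ih2]
      omega

theorem unV_pos (m : ℕ) (l : List ℕ) (h : ∀ x ∈ l, 0 < x) : ∀ x ∈ unV m l, 0 < x := by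
  induction l generalizing m with
  | nil => grind [unV]
  | cons b l ih =>
    have hb := h b (by simp)
    grind [unV, unstepFst_pos, unstepSnd_pos]

theorem V_unV (m : ℕ) (l : List ℕ) (h : ∀ x ∈ l, 0 < x) :
    V (unV m l) = List.replicate m 1 ++ l := by
  induction l generalizing m with
  | nil =>
    by_cases hm : m = 0 <;> simp [unV, V, hm, Vstep_zero_right]
  | cons b l ih =>
    have hb := h b (by simp)
    have ih' := fun m => ih m fun z hz => h z (by simp [hz])
    by_cases h1 : b = 1
    · simp [unV, h1, ih', List.replicate_succ']
    · simp [unV, h1, V, ih', Vstep_unstep (show 2 ≤ b by omega)]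

theorem V_bijOn (n : ℕ) (hn : 0 < n) :
    Set.BijOn V {l : List ℕ | IsComposition n l} {l : List ℕ | IsComposition n l} := by
  refine Set.InvOn.bijOn (f' := unV 0) ⟨?_, ?_⟩ ?_ ?_
  · exact fun l hl => unV_V l hl.1
  · exact fun l hl => by simpa using V_unV 0 l hl.1
  · rintro l ⟨hpos, rfl⟩
    exact V_isComposition l hpos
  · rintro l ⟨hpos, rfl⟩
    have hp := unV_pos 0 l hpos
    have hs := (V_isComposition _ hp).2
    rw [V_unV 0 l hpos] at hs
    exact ⟨hp, by simpa using hs.symm⟩
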